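/- Let q be a prime power, r ≥ 2 an even integer, a ∈ F\{0} and b ∈ F with b^q ≠ b, where F = GF(q²). Suppose that either q is odd and 4a^{q+1} + (b^q − b)² is a non-zero square of GF(q), or q is even and Tr_q(a^{q+1}/(b^q + b)²) = 1. Set j = q^{2r−3} − q^{r−2}. Then for every nonzero vector u = (u₀,u₁,…,u_r) ∈ F^{r+1}, the quantity #{x ∈ B(a,b) : u₀ + u₁x₁ + ⋯ + u_rx_r = 0} + j·[u_r = 0] (where [u_r = 0] is 1 if u_r = 0 and 0 otherwise) belongs to the three-element set { q^{2r−3} − q^{r−2}, 2q^{2r−3} − q^{r−2}, q^{2r−3} − q^{r−2} + q^{r−1} }; that is, the multiset obtained from B(a,b) by adjoining the point at infinity P∞ = (0,…,0,1) with multiplicity j is a 3-character multiset of PG(r,q²) with respect to hyperplanes. -/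

import Mathlib

open Finset

/-- The affine point set `B(a,b) ⊆ AG(r,q²)`: a point of `F^r` is encoded as a pair
consisting of its first `r - 1` coordinates `(x₁, …, x_{r-1})` together with its last
coordinate `x_r`.  It consists of the solutions of
`x_r^q − x_r + a^q(x₁^{2q}+⋯+x_{r−1}^{2q}) − a(x₁²+⋯+x_{r−1}²)
  = (b^q − b)(x₁^{q+1}+⋯+x_{r−1}^{q+1})`. -/
def BSet (q r : ℕ) {F : Type*} [Field F] (a b : F) :
    Set ((Fin (r - 1) → F) × F) :=
  {x | x.2 ^ q - x.2 + a ^ q * (∑ i, x.1 i ^ (2 * q)) - a * (∑ i, x.1 i ^ 2)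
      = (b ^ q - b) * ∑ i, x.1 i ^ (q + 1)}

section helpers18

variable {F : Type*} [Field F] [Fintype F] [DecidableEq F]

lemma h18_mul_count {K : Type*} [Field K] [Fintype K] [DecidableEq K] (c : K) :
    (univ.filter (fun p : K × K => p.1 * p.2 = c)).card + 1 =
      Fintype.card K + if c = 0 then Fintype.card K else 0 := by
  have h1 : (univ.filter (fun p : K × K => p.1 * p.2 = c)).card =
      ∑ x : K, (univ.filter (fun y : K => x * y = c)).card := by
    simp only [Finset.card_filter, Fintype.sum_prod_type]
  have h2 : ∀ x : K, x ≠ 0 → (univ.filter (fun y : K => x * y = c)).card = 1 := by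
    intro x hx
    rw [Finset.card_eq_one]
    refine ⟨x⁻¹ * c, ?_⟩
    ext y
    simp only [mem_filter, mem_univ, true_and, mem_singleton]
    constructor
    · rintro rfl; field_simp
    · rintro rfl; field_simp
  have h3 : (univ.filter (fun y : K => (0 : K) * y = c)).card =
      if c = 0 then Fintype.card K else 0 := by
    by_cases hc : c = 0
    · simp [hc]
    · simp [hc, Ne.symm hc]
  rw [h1, ← Finset.add_sum_erase univ _ (mem_univ (0 : K)), h3,
    Finset.sum_congr rfl (g := fun _ => 1) (fun x hx => h2 x (Finset.ne_of_mem_erase hx))]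
  simp only [Finset.sum_const, Finset.card_erase_of_mem (mem_univ (0 : K)), Finset.card_univ]
  have := Fintype.card_pos (α := K)
  simp only [smul_eq_mul, mul_one]
  omega

/-- fixed field -/
lemma h18_K (q : ℕ) (hq : 1 < q) (σ : F →+* F) (hσ : ∀ x, σ x = x ^ q)
    (hF : Fintype.card F = q ^ 2) (b : F) (hb : σ b ≠ b) :
    Nat.card (RingHom.eqLocusField σ (RingHom.id F)) = q ∧
    ∀ c, σ c = -c → (univ.filter (fun x => σ x - x = c)).card = q := by
  classical
  have hσσ : ∀ x, σ (σ x) = x := by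
    intro x
    rw [hσ, hσ, ← pow_mul, ← sq, ← hF, FiniteField.pow_card]
  let φ : F →+ F := σ.toAddMonoidHom - AddMonoidHom.id F
  have hφ : ∀ x, φ x = σ x - x := fun x => rfl
  have hKc : Nat.card (RingHom.eqLocusField σ (RingHom.id F)) =
      (univ.filter (fun x => σ x = x)).card := by
    rw [← Fintype.card_subtype, ← Nat.card_eq_fintype_card]
    rfl
  set k := (univ.filter (fun x => σ x = x)).card with hk
  have hδ : σ b - b ≠ 0 := sub_ne_zero.2 hb
  have hδ2 : σ (σ b - b) = - (σ b - b) := by rw [map_sub, hσσ]; ring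
  -- T has card k
  have hT : (univ.filter (fun x => σ x = -x)).card = k := by
    symm
    apply Finset.card_bij (fun x _ => (σ b - b) * x)
    · intro x hx
      simp only [mem_filter, mem_univ, true_and] at hx ⊢
      rw [map_mul, hδ2, hx]; ring
    · intro x _ y _ h
      exact mul_left_cancel₀ hδ h
    · intro y hy
      simp only [mem_filter, mem_univ, true_and] at hy
      refine ⟨y / (σ b - b), ?_, by field_simp⟩
      simp only [mem_filter, mem_univ, true_and]
      rw [map_div₀, hδ2, hy, neg_div_neg_eq]
  have hle : k ≤ q := by
    have hne := FiniteField.X_pow_card_sub_X_ne_zero F hq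
    have hd := FiniteField.X_pow_card_sub_X_natDegree_eq F hq
    calc k ≤ (Polynomial.X ^ q - Polynomial.X : Polynomial F).roots.toFinset.card := by
          apply Finset.card_le_card
          intro x hx
          simp only [mem_filter, mem_univ, true_and] at hx
          rw [Multiset.mem_toFinset, Polynomial.mem_roots hne]
          simp [← hσ, hx]
      _ ≤ _ := Multiset.toFinset_card_le _
      _ ≤ _ := Polynomial.card_roots' _
      _ = q := hd
  have hfib : ∀ c, (univ.filter (fun x => σ x - x = c)).card ≤ k := by
    intro c
    by_cases hc : ∃ x0, σ x0 - x0 = c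
    · obtain ⟨x0, hx0⟩ := hc
      apply Finset.card_le_card_of_injOn (fun x => x - x0)
      · intro x hx
        simp only [coe_filter, mem_univ, true_and, Set.mem_ofPred_eq] at hx ⊢
        rw [map_sub]
        linear_combination hx - hx0
      · intro x _ y _ h
        simpa using h
    · rw [Finset.filter_false_of_mem]
      · simp
      · intro x _ h
        exact hc ⟨x, h⟩
  have hsum : ∑ c ∈ univ.filter (fun x => σ x = -x),
      (univ.filter (fun x => σ x - x = c)).card = q ^ 2 := by
    rw [← hF, ← Finset.card_univ]
    symm
    apply Finset.card_eq_sum_card_fiberwise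
    intro x _
    simp only [coe_filter, mem_univ, true_and, Set.mem_ofPred_eq]
    rw [map_sub, hσσ]; ring
  have hle2 : q ^ 2 ≤ k * k := by
    rw [← hsum]
    calc _ ≤ ∑ c ∈ univ.filter (fun x => σ x = -x), k := Finset.sum_le_sum (fun c _ => hfib c)
      _ = k * k := by rw [Finset.sum_const, hT, smul_eq_mul]
  have hkq : k = q := by nlinarith
  refine ⟨hKc.trans hkq, ?_⟩
  have heq : ∑ c ∈ univ.filter (fun x => σ x = -x),
      (univ.filter (fun x => σ x - x = c)).card = ∑ c ∈ univ.filter (fun x => σ x = -x), k := by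
    rw [hsum, Finset.sum_const, hT, smul_eq_mul, hkq, sq]
  rw [Finset.sum_eq_sum_iff_of_le (fun c _ => hfib c)] at heq
  intro c hc
  rw [heq c (by simp [hc]), hkq]

/-- existence of w with σ w = y w -/
lemma h18_w (σ : F →+* F) (hσσ : ∀ x, σ (σ x) = x) (b : F) (hb : σ b ≠ b) (y : F)
    (hy : y * σ y = 1) : ∃ w, w ≠ 0 ∧ σ w = y * w := by
  by_contra! H
  have key : ∀ z, z + σ y * σ z = 0 := by
    intro z
    by_contra hz
    apply H _ hz
    rw [map_add, map_mul, hσσ, hσσ]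
    linear_combination (-(σ z)) * hy
  have h1 := key 1
  rw [map_one] at h1
  have h2 := key b
  apply hb
  linear_combination h1 * σ b - h2

lemma h18_count1 (q : ℕ) (hq : 1 < q) (σ : F →+* F) (hσ : ∀ x, σ x = x ^ q)
    (hF : Fintype.card F = q ^ 2) (a b : F) (ha : a ≠ 0) (hb : σ b ≠ b)
    (hD : 4 * (a * σ a) + (σ b - b) ^ 2 ≠ 0)
    (y : F) (hy : y * σ y = 1) (hya : σ a * y ^ 2 - (σ b - b) * y - a = 0) (v : F) :
    ∃ e, σ e = - e ∧ ∀ t, σ t = -t →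
      (univ.filter (fun x => σ a * σ x ^ 2 - a * x ^ 2 - (σ b - b) * (x * σ x)
        + (σ (v * x) - v * x) = t)).card + 1 = q + if t = e then q else 0 := by
  classical
  have hσσ : ∀ x, σ (σ x) = x := by
    intro x
    rw [hσ, hσ, ← pow_mul, ← sq, ← hF, FiniteField.pow_card]
  have hK := (h18_K q hq σ hσ hF b hb).1
  have hσa : σ a ≠ 0 := by simpa using ha
  set β := σ b - b with hβ
  have hσβ : σ β = -β := by rw [hβ, map_sub, hσσ]; ring
  obtain ⟨y', hy'⟩ : ∃ y', y' = β / σ a - y := ⟨_, rfl⟩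
  have hys : σ a * (y + y') = β := by rw [hy']; field_simp; ring
  have hyp : σ a * (y * y') = -a := by linear_combination y * hys - hya
  have hy0 : y ≠ 0 := by rintro rfl; simp at hy
  have hne : y' ≠ y := by
    intro h
    rw [h] at hys hyp
    apply hD
    linear_combination 4 * σ a * hyp - (β + σ a * (y + y)) * hys
  have hy'n : y' * σ y' = 1 := by
    have h1 := congrArg σ hyp
    rw [map_mul, map_mul, hσσ, map_neg] at h1
    have h2 : (a * σ a) * (y' * σ y') = a * σ a := by
      linear_combination (a * σ y * σ y') * hyp - a * h1 - (a * σ a * (y' * σ y')) * hy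
    exact mul_left_cancel₀ (mul_ne_zero ha hσa) (by rw [h2, mul_one])
  have hya' : σ a * y' ^ 2 - β * y' - a = 0 := by linear_combination y' * hys - hyp
  obtain ⟨w, hw0, hw⟩ := h18_w σ hσσ b hb y hy
  obtain ⟨w', hw0', hw'⟩ := h18_w σ hσσ b hb y' hy'n
  set B := 2 * (σ a * (σ w * σ w')) - 2 * (a * (w * w')) - β * (w * σ w' + w' * σ w) with hB
  have hσB : σ B = - B := by
    rw [hB]
    simp only [map_sub, map_mul, map_add, hσσ, hσβ, map_ofNat]
    ring
  have hB0 : B ≠ 0 := by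
    have : B * σ a = - (4 * (a * σ a) + β ^ 2) * (w * w') := by
      rw [hB, hw, hw']
      linear_combination (2 * σ a * w * w') * hyp - (β * w * w') * hys
    intro h
    rw [h, zero_mul] at this
    exact mul_ne_zero (neg_ne_zero.2 hD) (mul_ne_zero hw0 hw0') this.symm
  set K := RingHom.eqLocusField σ (RingHom.id F) with hKdef
  have : Fintype K := Fintype.ofFinite _
  rw [Nat.card_eq_fintype_card] at hK
  have hKm : ∀ x : F, x ∈ K ↔ σ x = x := fun x => Iff.rfl
  have hKσ : ∀ x : K, σ (x : F) = x := fun x => x.2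
  have hdiv : ∀ t, σ t = -t → t / B ∈ K := by
    intro t ht
    rw [hKm, map_div₀, ht, hσB, neg_div_neg_eq]
  have hvT : ∀ x, σ (σ x - x) = - (σ x - x) := by
    intro x; rw [map_sub, hσσ]; ring
  -- K-coordinates of the linear part
  obtain ⟨l, hl⟩ : ∃ l : K, (l : F) * B = σ (v * w) - v * w :=
    ⟨⟨_, hdiv _ (hvT (v * w))⟩, by field_simp⟩
  obtain ⟨l', hl'⟩ : ∃ l' : K, (l' : F) * B = σ (v * w') - v * w' :=
    ⟨⟨_, hdiv _ (hvT (v * w'))⟩, by field_simp⟩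
  -- coordinates
  let Φ : K × K → F := fun p => ((p.1 : F) - l') * w + ((p.2 : F) - l) * w'
  have hΦinj : Function.Injective Φ := by
    rintro ⟨p1, p2⟩ ⟨r1, r2⟩ h
    have h0 : ((p1 : F) - r1) * w + ((p2 : F) - r2) * w' = 0 := by
      simp only [Φ] at h
      linear_combination h
    have h1 := congrArg σ h0
    rw [map_zero, map_add, map_mul, map_mul, map_sub, map_sub, hKσ, hKσ, hKσ, hKσ, hw, hw'] at h1
    have h2 : (y' - y) * (((p2 : F) - r2) * w') = 0 := by linear_combination h1 - y * h0
    have h3 : ((p2 : F) - r2) = 0 := by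
      rcases mul_eq_zero.1 h2 with h | h
      · exact absurd (sub_eq_zero.1 h) hne
      · exact (mul_eq_zero.1 h).resolve_right hw0'
    have h4 : ((p1 : F) - r1) = 0 := by
      rw [h3, zero_mul, add_zero] at h0
      exact (mul_eq_zero.1 h0).resolve_right hw0
    exact Prod.ext (Subtype.ext (sub_eq_zero.1 h4)) (Subtype.ext (sub_eq_zero.1 h3))
  have hΦ : Function.Bijective Φ := by
    rw [Fintype.bijective_iff_injective_and_card]
    refine ⟨hΦinj, ?_⟩
    rw [Fintype.card_prod, hF, hK, sq]
  refine ⟨-(B * l * l'), ?_, ?_⟩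
  · rw [map_neg, map_mul, map_mul, hKσ, hKσ, hσB]; ring
  intro t ht
  obtain ⟨c, hc⟩ : ∃ c : K, (c : F) * B = t + B * l * l' :=
    ⟨⟨(t + B * l * l') / B, hdiv _ (by
      rw [map_add, map_mul, map_mul, hKσ, hKσ, hσB, ht]; ring)⟩, by field_simp⟩
  have hcc := h18_mul_count c
  rw [hK] at hcc
  have hiff : c = 0 ↔ t = -(B * l * l') := by
    rw [← add_eq_zero_iff_eq_neg, ← hc]
    simp [hB0]
  rw [← if_congr hiff rfl rfl, ← hcc]
  congr 1
  symm
  apply Finset.card_bij (fun p _ => Φ p)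
  · intro p hp
    simp only [mem_filter, mem_univ, true_and] at hp ⊢
    have hp' : (p.1 : F) * p.2 = c := by rw [← hp]; rfl
    have e1 : σ (Φ p) = ((p.1 : F) - l') * (y * w) + ((p.2 : F) - l) * (y' * w') := by
      simp only [Φ]
      rw [map_add, map_mul, map_mul, map_sub, map_sub, hKσ, hKσ, hKσ, hKσ, hw, hw']
    have e2 : Φ p = ((p.1 : F) - l') * w + ((p.2 : F) - l) * w' := rfl
    rw [map_mul, e1, e2]
    rw [map_mul, hw] at hl
    rw [map_mul, hw'] at hl'
    have hB' : B = 2 * (σ a * (y * w * (y' * w'))) - 2 * (a * (w * w'))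
        - β * (w * (y' * w') + w' * (y * w)) := by rw [hB, hw, hw']
    linear_combination (((p.1 : F) - l') * w) ^ 2 * hya + (((p.2 : F) - l) * w') ^ 2 * hya'
      - (((p.1 : F) - l') * ((p.2 : F) - l)) * hB' + B * hp' + hc
      - ((p.1 : F) - l') * hl - ((p.2 : F) - l) * hl'
  · intro p _ r _ h
    exact hΦ.1 h
  · intro x hx
    obtain ⟨p, rfl⟩ := hΦ.2 x
    refine ⟨p, ?_, rfl⟩
    simp only [mem_filter, mem_univ, true_and] at hx ⊢
    have e1 : σ (Φ p) = ((p.1 : F) - l') * (y * w) + ((p.2 : F) - l) * (y' * w') := by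
      simp only [Φ]
      rw [map_add, map_mul, map_mul, map_sub, map_sub, hKσ, hKσ, hKσ, hKσ, hw, hw']
    have e2 : Φ p = ((p.1 : F) - l') * w + ((p.2 : F) - l) * w' := rfl
    rw [map_mul, e1, e2] at hx
    rw [map_mul, hw] at hl
    rw [map_mul, hw'] at hl'
    have hB' : B = 2 * (σ a * (y * w * (y' * w'))) - 2 * (a * (w * w'))
        - β * (w * (y' * w') + w' * (y * w)) := by rw [hB, hw, hw']
    apply Subtype.ext
    apply mul_left_cancel₀ hB0
    change B * ((p.1 : F) * p.2) = B * c
    linear_combination hx - ((((p.1 : F) - l') * w) ^ 2 * hya + (((p.2 : F) - l) * w') ^ 2 * hya'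
      - (((p.1 : F) - l') * ((p.2 : F) - l)) * hB' + hc
      - ((p.1 : F) - l') * hl - ((p.2 : F) - l) * hl')

lemma h18_sum (q : ℕ) (σ : F →+* F) (hF : Fintype.card F = q ^ 2) (n : ℕ) :
    ∀ (g : Fin n → F → F) (_ : ∀ i x, σ (g i x) = - g i x)
    (_ : ∀ i, ∃ e, σ e = - e ∧ ∀ t, σ t = -t →
      (univ.filter (fun x => g i x = t)).card + 1 = q + if t = e then q else 0),
    ∃ e, σ e = - e ∧ ∀ t, σ t = -t →
      q * (univ.filter (fun x : Fin n → F => ∑ i, g i (x i) = t)).card + q ^ n =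
        q ^ (2 * n) + if t = e then q ^ (n + 1) else 0 := by
  induction n with
  | zero =>
    intro g _ _
    refine ⟨0, by simp, ?_⟩
    intro t _
    by_cases h : t = 0
    · simp [h, add_comm]
    · simp [h, Ne.symm h]
  | succ n ih =>
    intro g hg h1
    obtain ⟨e, he, H⟩ := ih (fun i => g i.succ) (fun i => hg _) (fun i => h1 _)
    obtain ⟨e0, he0, H0⟩ := h1 0
    refine ⟨e + e0, by rw [map_add, he, he0]; ring, ?_⟩
    intro t ht
    have hc : (univ.filter (fun x : Fin (n + 1) → F => ∑ i, g i (x i) = t)).card =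
        ∑ x0 : F, (univ.filter (fun x : Fin n → F => ∑ i, g i.succ (x i) = t - g 0 x0)).card := by
      simp only [Finset.card_filter]
      rw [← (Fin.consEquiv (fun _ => F)).sum_comp, Fintype.sum_prod_type]
      refine Finset.sum_congr rfl fun x0 _ => Finset.sum_congr rfl fun x _ => ?_
      refine if_congr ?_ rfl rfl
      rw [Fin.sum_univ_succ]
      simp [Fin.consEquiv, eq_sub_iff_add_eq']
    have h2 : ∑ x0 : F, (q * (univ.filter
        (fun x : Fin n → F => ∑ i, g i.succ (x i) = t - g 0 x0)).card + q ^ n) =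
        ∑ x0 : F, (q ^ (2 * n) + if t - g 0 x0 = e then q ^ (n + 1) else 0) := by
      refine Finset.sum_congr rfl fun x0 _ => H _ ?_
      rw [map_sub, ht, hg]; ring
    rw [Finset.sum_add_distrib, Finset.sum_add_distrib, ← Finset.mul_sum, ← hc,
      Finset.sum_const, Finset.sum_const, Finset.card_univ, hF, ← Finset.sum_filter,
      Finset.sum_const] at h2
    have h3 : (univ.filter (fun x0 => t - g 0 x0 = e)) = univ.filter (fun x0 => g 0 x0 = t - e) := by
      ext x
      simp only [mem_filter, mem_univ, true_and]
      constructor <;> intro h <;> linear_combination -h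
    rw [h3] at h2
    have h4 := H0 (t - e) (by rw [map_sub, ht, he]; ring)
    have h5 : t - e = e0 ↔ t = e + e0 := sub_eq_iff_eq_add'
    rw [if_congr h5 rfl rfl] at h4
    simp only [smul_eq_mul] at h2
    split_ifs at h4 ⊢ <;>
    · zify at h2 h4 ⊢
      linear_combination h2 + (q : ℤ) ^ (n + 1) * h4

lemma h18_y (q : ℕ) (hq : 1 < q) (σ : F →+* F) (hσ : ∀ x, σ x = x ^ q)
    (hF : Fintype.card F = q ^ 2) (a b : F) (ha : a ≠ 0) (hb : σ b ≠ b)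
    (hab : (Odd q ∧
        ∃ s : F, s ≠ 0 ∧ s ^ q = s ∧ 4 * a ^ (q + 1) + (b ^ q - b) ^ 2 = s ^ 2) ∨
      (Even q ∧ ∃ h : ℕ, q = 2 ^ h ∧
        ∑ i ∈ Finset.range h, (a ^ (q + 1) / (b ^ q + b) ^ 2) ^ 2 ^ i = 1)) :
    4 * (a * σ a) + (σ b - b) ^ 2 ≠ 0 ∧
    ∃ y, y * σ y = 1 ∧ σ a * y ^ 2 - (σ b - b) * y - a = 0 := by
  have hσσ : ∀ x, σ (σ x) = x := by
    intro x
    rw [hσ, hσ, ← pow_mul, ← sq, ← hF, FiniteField.pow_card]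
  have hσa : σ a ≠ 0 := by simpa using ha
  have hβ0 : σ b - b ≠ 0 := sub_ne_zero.2 hb
  have hN : a ^ (q + 1) = a * σ a := by rw [hσ]; ring
  have hFq : (q : F) = 0 := by
    have : ((q ^ 2 : ℕ) : F) = 0 := by rw [← hF]; exact FiniteField.cast_card_eq_zero F
    simpa using this
  rcases hab with ⟨hodd, s, hs0, hsq, hs⟩ | ⟨heven, h, hqh, htr⟩
  · rw [← hσ, hN] at hs
    rw [← hσ] at hsq
    refine ⟨by rw [hs]; exact pow_ne_zero 2 hs0, ?_⟩
    have h2 : (2 : F) ≠ 0 := by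
      intro h2
      obtain ⟨m, hm⟩ := hodd
      rw [hm] at hFq
      push_cast at hFq
      rw [h2] at hFq
      simp at hFq
    refine ⟨(σ b - b + s) / (2 * σ a), ?_, ?_⟩
    · rw [map_div₀, map_add, map_sub, map_mul, hσσ, hσσ, hsq, map_ofNat]
      field_simp
      linear_combination -hs
    · field_simp
      linear_combination -hs
  · have hh : h ≠ 0 := by rintro rfl; simp at hqh; omega
    have h2 : (2 : F) = 0 := by
      rw [hqh] at hFq
      push_cast at hFq
      exact pow_eq_zero_iff hh |>.1 hFq
    haveI : CharP F 2 := CharTwo.of_one_ne_zero_of_two_eq_zero one_ne_zero h2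
    refine ⟨?_, ?_⟩
    · have : 4 * (a * σ a) + (σ b - b) ^ 2 = (σ b - b) ^ 2 := by linear_combination 2 * (a * σ a) * h2
      rw [this]; exact pow_ne_zero 2 hβ0
    have hβ' : b ^ q + b = σ b - b := by rw [← hσ]; linear_combination b * h2
    rw [hβ', hN] at htr
    set β := σ b - b with hβ
    have hσβ : σ β = β := by rw [hβ, map_sub, hσσ]; linear_combination (b - σ b) * h2
    set d := a * σ a / β ^ 2 with hd
    have hσd : σ d = -d := by
      rw [hd, map_div₀, map_mul, hσσ, map_pow, hσβ]
      linear_combination (a * σ a / β ^ 2) * h2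
    have hfib := (h18_K q hq σ hσ hF b hb).2 d hσd
    obtain ⟨x, hx⟩ : (univ.filter (fun x => σ x - x = d)).Nonempty := by
      rw [← Finset.card_pos]; omega
    simp only [mem_filter, mem_univ, true_and] at hx
    obtain ⟨z, hz⟩ : ∃ z, z = ∑ i ∈ Finset.range h, x ^ 2 ^ i := ⟨_, rfl⟩
    have hz2 : z ^ 2 - z = d := by
      rw [hz, sum_pow_char 2, ← Finset.sum_sub_distrib]
      have : ∀ i ∈ Finset.range h, (x ^ 2 ^ i) ^ 2 - x ^ 2 ^ i = x ^ 2 ^ (i + 1) - x ^ 2 ^ i := by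
        intro i _; rw [← pow_mul, ← pow_succ]
      rw [Finset.sum_congr rfl this, Finset.sum_range_sub (fun i => x ^ 2 ^ i), ← hqh, ← hσ]
      simpa using hx
    have hz3 : σ z = z + 1 := by
      rw [← htr, hz, map_sum, ← Finset.sum_add_distrib]
      refine Finset.sum_congr rfl fun i _ => ?_
      rw [map_pow, ← add_pow_char_pow]
      congr 1
      linear_combination hx
    have hdβ : d * β ^ 2 = a * σ a := by rw [hd]; field_simp
    refine ⟨β * z / σ a, ?_, ?_⟩
    · rw [map_div₀, map_mul, hσσ, hσβ, hz3]
      field_simp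
      linear_combination β ^ 2 * hz2 + hdβ + β ^ 2 * z * h2
    · field_simp
      linear_combination β ^ 2 * hz2 + hdβ

lemma h18_hyper (q m : ℕ) (hF : Fintype.card F = q ^ 2) (u : Fin (m + 1) → F)
    (hu : u ≠ 0) (c : F) (hq : 0 < q) :
    (univ.filter (fun x : Fin (m + 1) → F => c + ∑ i, u i * x i = 0)).card = q ^ (2 * m) := by
  obtain ⟨i, hi⟩ := Function.ne_iff.1 hu
  simp only [Pi.zero_apply] at hi
  have key : (univ.filter (fun x : Fin (m + 1) → F => c + ∑ i, u i * x i = 0)).card =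
      (univ : Finset (Fin m → F)).card := by
    symm
    apply Finset.card_bij (fun (x : Fin m → F) _ => i.insertNth (α := fun _ => F) (-(c + ∑ k, u (i.succAbove k) * x k) / u i) x)
    · intro x _
      simp only [mem_filter, mem_univ, true_and]
      rw [Fin.sum_univ_succAbove _ i]
      simp only [Fin.insertNth_apply_same, Fin.insertNth_apply_succAbove]
      field_simp
      ring
    · intro x _ y _ h
      funext k
      have := congrFun h (i.succAbove k)
      simpa using this
    · intro x hx
      simp only [mem_filter, mem_univ, true_and] at hx
      refine ⟨fun k => x (i.succAbove k), mem_univ _, ?_⟩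
      rw [Fin.sum_univ_succAbove _ i] at hx
      rw [Fin.insertNth_eq_iff]
      refine ⟨?_, rfl⟩
      field_simp
      linear_combination -hx
  rw [key, Finset.card_univ, Fintype.card_pi]
  simp [hF, ← pow_mul]

end helpers18

/-- for `r ≥ 2` even, under the odd-square / even-trace hypothesis, the
multiset obtained from `B(a,b)` by adjoining `P∞ = (0,…,0,1)` with multiplicity
`j = q^{2r−3} − q^{r−2}` is a `3`-character multiset of `PG(r,q²)`: for every nonzero
`u = (u₀,(u₁,…,u_{r−1}),u_r) ∈ F^{r+1}`, the multiset intersection number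
`#{x ∈ B(a,b) : u₀ + u₁x₁ + ⋯ + u_rx_r = 0} + j·[u_r = 0]` lies in
`{q^{2r−3} − q^{r−2}, 2q^{2r−3} − q^{r−2}, q^{2r−3} − q^{r−2} + q^{r−1}}`. -/
theorem statement18 (q r : ℕ) (hq : IsPrimePow q) (hr : 2 ≤ r) (hreven : Even r)
    {F : Type*} [Field F] [Fintype F] [DecidableEq F] (hF : Fintype.card F = q ^ 2)
    (a b : F) (ha : a ≠ 0) (hb : b ^ q ≠ b)
    (hab : (Odd q ∧
        ∃ s : F, s ≠ 0 ∧ s ^ q = s ∧ 4 * a ^ (q + 1) + (b ^ q - b) ^ 2 = s ^ 2) ∨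
      (Even q ∧ ∃ h : ℕ, q = 2 ^ h ∧
        ∑ i ∈ Finset.range h, (a ^ (q + 1) / (b ^ q + b) ^ 2) ^ 2 ^ i = 1)) :
    ∀ u : F × (Fin (r - 1) → F) × F, u ≠ 0 →
      Set.ncard {x ∈ BSet q r a b |
          u.1 + (∑ i, u.2.1 i * x.1 i) + u.2.2 * x.2 = 0}
        + (if u.2.2 = 0 then q ^ (2 * r - 3) - q ^ (r - 2) else 0) ∈
      ({q ^ (2 * r - 3) - q ^ (r - 2), 2 * q ^ (2 * r - 3) - q ^ (r - 2),
        q ^ (2 * r - 3) - q ^ (r - 2) + q ^ (r - 1)} : Set ℕ) := by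
  obtain ⟨p, k, hp, hk, hpk⟩ := hq
  have hp' : p.Prime := hp.nat_prime
  haveI : Fact p.Prime := ⟨hp'⟩
  have hq1 : 1 < q := by
    rw [← hpk]; exact Nat.one_lt_pow hk.ne' hp'.one_lt
  haveI : CharP F p := by
    apply charP_of_card_eq_prime_pow (f := k * 2)
    rw [hF, ← hpk, pow_mul]
  obtain ⟨σ, hσ⟩ : ∃ σ : F →+* F, ∀ x, σ x = x ^ q :=
    ⟨iterateFrobenius F p k, fun x => by rw [iterateFrobenius_def, hpk]⟩
  have hσσ : ∀ x, σ (σ x) = x := by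
    intro x
    rw [hσ, hσ, ← pow_mul, ← sq, ← hF, FiniteField.pow_card]
  have hb' : σ b ≠ b := by rwa [hσ]
  obtain ⟨n, rfl⟩ : ∃ n, r = n + 2 := ⟨r - 2, by omega⟩
  obtain ⟨hD, y, hy, hya⟩ := h18_y q hq1 σ hσ hF a b ha hb' hab
  have hfib := (h18_K q hq1 σ hσ hF b hb').2
  have e1 : 2 * (n + 2) - 3 = 2 * n + 1 := by omega
  have e2 : n + 2 - 2 = n := by omega
  have e3 : n + 2 - 1 = n + 1 := by omega
  have hmem : ∀ x : (Fin (n + 1) → F) × F, x ∈ BSet q (n + 2) a b ↔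
      σ x.2 - x.2 + ∑ i, (σ a * σ (x.1 i) ^ 2 - a * (x.1 i) ^ 2
        - (σ b - b) * (x.1 i * σ (x.1 i))) = 0 := by
    intro x
    change (x.2 ^ q - x.2 + a ^ q * (∑ i : Fin (n + 1), x.1 i ^ (2 * q))
      - a * (∑ i : Fin (n + 1), x.1 i ^ 2)
      = (b ^ q - b) * ∑ i : Fin (n + 1), x.1 i ^ (q + 1)) ↔ _
    rw [← sub_eq_zero]
    rw [Finset.sum_sub_distrib, Finset.sum_sub_distrib, ← Finset.mul_sum, ← Finset.mul_sum,
      ← Finset.mul_sum]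
    have f1 : ∀ z : F, z ^ (2 * q) = σ z ^ 2 := by intro z; rw [hσ, ← pow_mul, mul_comm]
    have f2 : ∀ z : F, z ^ (q + 1) = z * σ z := by intro z; rw [hσ, pow_succ, mul_comm]
    simp only [f1, f2, ← hσ]
    constructor <;> intro h <;> linear_combination h
  have hfT : ∀ x : F, σ (σ a * σ x ^ 2 - a * x ^ 2 - (σ b - b) * (x * σ x)) =
      -(σ a * σ x ^ 2 - a * x ^ 2 - (σ b - b) * (x * σ x)) := by
    intro x
    simp only [map_sub, map_mul, map_pow, hσσ]
    ring
  have main : ∀ S : Set ((Fin (n + 1) → F) × F), (∀ x : (Fin (n + 1) → F) × F, x ∈ S ↔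
      σ x.2 - x.2 + ∑ i, (σ a * σ (x.1 i) ^ 2 - a * (x.1 i) ^ 2
        - (σ b - b) * (x.1 i * σ (x.1 i))) = 0) →
      ∀ u : F × (Fin (n + 1) → F) × F, u ≠ 0 →
      Set.ncard {x ∈ S | u.1 + (∑ i, u.2.1 i * x.1 i) + u.2.2 * x.2 = 0}
        + (if u.2.2 = 0 then q ^ (2 * n + 1) - q ^ n else 0) ∈
      ({q ^ (2 * n + 1) - q ^ n, 2 * q ^ (2 * n + 1) - q ^ n,
        q ^ (2 * n + 1) - q ^ n + q ^ (n + 1)} : Set ℕ) := by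
    clear hmem
    intro S hmem
    rintro ⟨u0, u1, u2⟩ hu
    dsimp only
    have hpow : q ^ n ≤ q ^ (2 * n + 1) := Nat.pow_le_pow_right (by omega) (by omega)
    by_cases h0 : u2 = 0
    · subst h0
      simp only [if_true, zero_mul, add_zero]
      by_cases h1 : u1 = 0
      · subst h1
        left
        have hu0 : u0 ≠ 0 := by
          rintro rfl; exact hu rfl
        have : {x ∈ S | u0 + ∑ i, (0 : Fin (n + 1) → F) i * x.1 i = 0} = ∅ := by
          ext x; simp [hu0]
        rw [this]; simp
      · right; left
        have hset : {x ∈ S | u0 + ∑ i, u1 i * x.1 i = 0} =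
            ((univ.filter (fun x : (Fin (n + 1) → F) × F => (σ x.2 - x.2 + ∑ i, (σ a * σ (x.1 i) ^ 2
              - a * (x.1 i) ^ 2 - (σ b - b) * (x.1 i * σ (x.1 i))) = 0) ∧
              u0 + ∑ i, u1 i * x.1 i = 0) : Finset _) : Set ((Fin (n + 1) → F) × F)) := by
          ext x
          rw [Set.mem_sep_iff, hmem]
          simp
        have hcard : Set.ncard {x ∈ S | u0 + ∑ i, u1 i * x.1 i = 0}
            = q ^ (2 * n + 1) := by
          rw [hset, Set.ncard_coe_finset, Finset.card_filter, Fintype.sum_prod_type]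
          have : ∀ x : Fin (n + 1) → F, (∑ z : F, if (σ z - z + ∑ i, (σ a * σ (x i) ^ 2
              - a * (x i) ^ 2 - (σ b - b) * (x i * σ (x i))) = 0) ∧
              u0 + ∑ i, u1 i * x i = 0 then 1 else 0) =
              if u0 + ∑ i, u1 i * x i = 0 then q else 0 := by
            intro x
            by_cases hx : u0 + ∑ i, u1 i * x i = 0
            · simp only [hx, and_true, if_true]
              rw [← Finset.card_filter]
              simp only [add_eq_zero_iff_eq_neg]
              apply hfib
              rw [map_neg, map_sum, Finset.sum_congr rfl (fun i _ => hfT (x i)),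
                Finset.sum_neg_distrib]
            · simp [hx]
          rw [Finset.sum_congr rfl (fun x _ => this x), ← Finset.sum_filter, Finset.sum_const,
            h18_hyper q n hF u1 h1 u0 (by omega), smul_eq_mul, pow_succ]
        have : Set.ncard {x ∈ S | u0 + ∑ i, u1 i * x.1 i = 0}
            + (q ^ (2 * n + 1) - q ^ n) = 2 * q ^ (2 * n + 1) - q ^ n := by
          rw [hcard]; omega
        exact this
    · rw [if_neg h0, add_zero]
      obtain ⟨c, hc⟩ : ∃ c, c = -u0 / u2 := ⟨_, rfl⟩
      let g : Fin (n + 1) → F → F := fun i x => σ a * σ x ^ 2 - a * x ^ 2 - (σ b - b) * (x * σ x)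
          + (σ ((-u1 i / u2) * x) - (-u1 i / u2) * x)
      obtain ⟨e, he, H⟩ := h18_sum q σ hF (n + 1) g
        (by intro i x
            simp only [g]
            rw [map_add, hfT, map_sub, hσσ]; ring)
        (fun i => h18_count1 q hq1 σ hσ hF a b ha hb' hD y hy hya (-u1 i / u2))
      have H' := H (c - σ c) (by rw [map_sub, hσσ]; ring)
      have hcard : Set.ncard {x ∈ S | u0 + ∑ i, u1 i * x.1 i + u2 * x.2 = 0}
          = (univ.filter (fun x : Fin (n + 1) → F => ∑ i, g i (x i) = c - σ c)).card := by
        have hlin : ∀ x : Fin (n + 1) → F, ∑ i, (-u1 i / u2) * x i = -(∑ i, u1 i * x i) / u2 := by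
          intro x
          rw [neg_div, Finset.sum_div, ← Finset.sum_neg_distrib]
          refine Finset.sum_congr rfl fun i _ => ?_
          ring
        have hg : ∀ x : Fin (n + 1) → F, ∑ i, g i (x i) = ∑ i, (σ a * σ (x i) ^ 2
            - a * (x i) ^ 2 - (σ b - b) * (x i * σ (x i))) +
            (σ (-(∑ i, u1 i * x i) / u2) - (-(∑ i, u1 i * x i) / u2)) := by
          intro x
          simp only [g]
          rw [Finset.sum_add_distrib, Finset.sum_sub_distrib (fun i => σ (-u1 i / u2 * x i)),
            ← map_sum, hlin]
        rw [← Set.ncard_coe_finset]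
        symm
        apply Set.ncard_congr (fun x _ => (x, c + -(∑ i, u1 i * x i) / u2))
        · intro x hx
          simp only [coe_filter, mem_univ, true_and, Set.mem_ofPred_eq] at hx
          rw [hg] at hx
          refine ⟨(hmem _).2 ?_, ?_⟩
          · simp only [map_add]
            linear_combination hx
          · simp only [hc]
            field_simp
            ring
        · intro x z _ _ h
          exact (Prod.ext_iff.1 h).1
        · rintro ⟨x, z⟩ ⟨hx1, hx2⟩
          rw [hmem] at hx1
          simp only at hx1 hx2
          have hz : z = c + -(∑ i, u1 i * x i) / u2 := by
            rw [hc]; field_simp; linear_combination hx2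
          refine ⟨x, ?_, ?_⟩
          · simp only [coe_filter, mem_univ, true_and, Set.mem_ofPred_eq]
            rw [hg]
            rw [hz, map_add] at hx1
            linear_combination hx1
          · rw [hz]
      rw [← hcard] at H'
      have hqp : 0 < q := by omega
      have key : ∀ N : ℕ, (q * N + q ^ (n + 1) = q ^ (2 * (n + 1)) +
          if c - σ c = e then q ^ (n + 1 + 1) else 0) →
          N ∈ ({q ^ (2 * n + 1) - q ^ n, 2 * q ^ (2 * n + 1) - q ^ n,
            q ^ (2 * n + 1) - q ^ n + q ^ (n + 1)} : Set ℕ) := by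
        intro N hN
        split_ifs at hN
        · right; right
          have : N + q ^ n = q ^ (2 * n + 1) + q ^ (n + 1) := by
            apply Nat.eq_of_mul_eq_mul_left hqp
            linear_combination hN
          have h : N = q ^ (2 * n + 1) - q ^ n + q ^ (n + 1) := by omega
          exact h
        · left
          have : N + q ^ n = q ^ (2 * n + 1) := by
            apply Nat.eq_of_mul_eq_mul_left hqp
            linear_combination hN
          omega
      exact key _ H'
  exact main (BSet q (n + 2) a b) hmem
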